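/- Let S = F[x_0,…,x_n] be a polynomial ring over a field F, with m = (x_0,…,x_n). Let f_1,…,f_c be a regular sequence of homogeneous forms in S of degrees d_1,…,d_c, set d := d_1 + ⋯ + d_c, and let J be the ideal generated by the c×c minors of the (n+1)×c Jacobian matrix (∂f_j/∂x_i). Assume J + (f_1,…,f_c)S is m-primary. Then for all positive integers a_2,…,a_c, setting N := d_1 + Σ_{i=2}^c d_i·a_i + (n+1−c)(d−c) − n, one has m^N ⊆ J + (f_1, f_2^{a_2}, …, f_c^{a_c})S. -/

import Mathlib

open MvPolynomial

section LocalAlgebra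

open IsLocalRing

variable {R : Type*} [CommRing R]

/-- `x` is a nonzerodivisor modulo the ideal `I`. -/
def IsRegularMod (I : Ideal R) (x : R) : Prop := ∀ z, x * z ∈ I → z ∈ I

/-- `R ⧸ I` admits a regular sequence of length `t` in the maximal ideal of `R`. -/
def DepthGE [IsLocalRing R] : ℕ → Ideal R → Prop
  | 0, _ => True
  | t + 1, I => ∃ x ∈ maximalIdeal R, IsRegularMod I x ∧ DepthGE t (I ⊔ Ideal.span {x})

theorem mem_sup_span_singleton_iff {I : Ideal R} {x z : R} :
    z ∈ I ⊔ Ideal.span {x} ↔ ∃ y, z - x * y ∈ I := by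
  rw [Submodule.mem_sup]
  constructor
  · rintro ⟨i, hi, w, hw, rfl⟩
    obtain ⟨y, rfl⟩ := Ideal.mem_span_singleton'.1 hw
    exact ⟨y, by simpa [mul_comm] using hi⟩
  · rintro ⟨y, hy⟩
    exact ⟨_, hy, x * y, Ideal.mem_span_singleton'.2 ⟨y, mul_comm _ _⟩, by ring⟩

theorem IsRegularMod.pow {I : Ideal R} {x : R} (h : IsRegularMod I x) (k : ℕ) :
    IsRegularMod I (x ^ k) := by
  induction k with
  | zero => intro z hz; simpa using hz
  | succ k ih => intro z hz; exact h _ (ih _ (by rwa [pow_succ, mul_assoc] at hz))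

theorem mem_associatedPrimes_quotient_iff [IsNoetherianRing R] {I P : Ideal R} :
    P ∈ associatedPrimes R (R ⧸ I) ↔ P.IsPrime ∧ ∃ w, ∀ r, r ∈ P ↔ r * w ∈ I := by
  rw [AssociatedPrimes.mem_iff, isAssociatedPrime_iff]
  refine and_congr_right fun _ => ?_
  rw [(Ideal.Quotient.mk_surjective (I := I)).exists]
  refine exists_congr fun w => ?_
  rw [SetLike.ext_iff]
  refine forall_congr' fun r => ?_
  rw [Submodule.mem_colon_singleton, Submodule.mem_bot,
    ← Ideal.Quotient.eq_zero_iff_mem (I := I), map_mul, Algebra.smul_def]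
  rfl

theorem exists_mem_associatedPrimes_quotient [IsNoetherianRing R] {I : Ideal R} {w : R}
    (hw : w ∉ I) : ∃ P ∈ associatedPrimes R (R ⧸ I), ∀ r, r * w ∈ I → r ∈ P := by
  obtain ⟨P, hP, hle⟩ := exists_le_isAssociatedPrime_of_isNoetherianRing R
    (Ideal.Quotient.mk I w) (by rwa [Ne, Ideal.Quotient.eq_zero_iff_mem])
  refine ⟨P, hP, fun r hr => hle ?_⟩
  rw [Submodule.mem_colon_singleton, Submodule.mem_bot, Algebra.smul_def]
  exact Ideal.Quotient.eq_zero_iff_mem.2 hr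

theorem not_isRegularMod_iff [IsNoetherianRing R] {I : Ideal R} {x : R} :
    ¬ IsRegularMod I x ↔ ∃ P ∈ associatedPrimes R (R ⧸ I), x ∈ P := by
  constructor
  · intro h
    simp only [IsRegularMod, not_forall] at h
    obtain ⟨w, hw, hwI⟩ := h
    obtain ⟨P, hP, h⟩ := exists_mem_associatedPrimes_quotient hwI
    exact ⟨P, hP, h x hw⟩
  · rintro ⟨P, hP, hx⟩ h
    obtain ⟨hp, w, hw⟩ := mem_associatedPrimes_quotient_iff.1 hP
    refine hp.ne_top ((Ideal.eq_top_iff_one _).2 ((hw 1).2 ?_))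
    simpa using h w ((hw x).1 hx)

theorem IsRegularMod.sup_swap {I : Ideal R} {x z : R}
    (hxI : IsRegularMod I x) (hz : IsRegularMod (I ⊔ Ideal.span {x}) z) :
    IsRegularMod (I ⊔ Ideal.span {z}) x := by
  intro w hw
  obtain ⟨v, hv⟩ := mem_sup_span_singleton_iff.1 hw
  obtain ⟨v', hv'⟩ := mem_sup_span_singleton_iff.1 (hz v (mem_sup_span_singleton_iff.2
    ⟨w, by simpa using I.neg_mem hv⟩))
  refine mem_sup_span_singleton_iff.2 ⟨v', hxI _ ?_⟩
  convert I.add_mem hv (I.mul_mem_left z hv') using 1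
  ring

variable [IsLocalRing R] [IsNoetherianRing R]

theorem le_of_le_sup_mul_of_mem_maximalIdeal {I K : Ideal R} {x : R} (hx : x ∈ maximalIdeal R)
    (h : ∀ u ∈ K, ∃ v ∈ K, u - x * v ∈ I) : K ≤ I := by
  refine Submodule.le_of_le_smul_of_le_jacobson_bot (I := Ideal.span {x})
    (IsNoetherian.noetherian K) ?_ ?_
  · rw [IsLocalRing.jacobson_eq_maximalIdeal _ bot_ne_top, Ideal.span_singleton_le_iff_mem]
    exact hx
  · intro u hu
    obtain ⟨v, hv, huv⟩ := h u hu
    rw [← sub_add_cancel u (x * v)]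
    exact Submodule.add_mem_sup huv
      (Submodule.smul_mem_smul (Ideal.mem_span_singleton_self x) hv)

theorem exists_isRegularMod_of_mem_maximalIdeal {I I' : Ideal R} {x x' : R}
    (hx : x ∈ maximalIdeal R) (hxI : IsRegularMod I x)
    (hx' : x' ∈ maximalIdeal R) (hxI' : IsRegularMod I' x') :
    ∃ z ∈ maximalIdeal R, IsRegularMod I z ∧ IsRegularMod I' z := by
  by_contra! hcon
  have hfin := (associatedPrimes.finite R (R ⧸ I)).union (associatedPrimes.finite R (R ⧸ I'))
  obtain ⟨P, hP, hle⟩ := (Ideal.subset_union_prime_finite hfin (f := id) ⊥ ⊥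
    (I := maximalIdeal R) (fun P hP _ _ => by
      rcases hP with hP | hP
      exacts [hP.isPrime, hP.isPrime])).1 (by
    intro z hz
    by_cases h : IsRegularMod I z
    · obtain ⟨P, hP, h⟩ := not_isRegularMod_iff.1 (hcon z hz h)
      exact Set.mem_biUnion (Or.inr hP) h
    · obtain ⟨P, hP, h⟩ := not_isRegularMod_iff.1 h
      exact Set.mem_biUnion (Or.inl hP) h)
  rcases hP with hP | hP
  · exact not_isRegularMod_iff.2 ⟨P, hP, hle hx⟩ hxI
  · exact not_isRegularMod_iff.2 ⟨P, hP, hle hx'⟩ hxI'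

/-- Positivity of depth does not depend on which nonzerodivisor has been divided out. -/
theorem exists_isRegularMod_sup_span_singleton {I : Ideal R} {x x' y : R}
    (hxI : IsRegularMod I x) (hx : x ∈ maximalIdeal R)
    (hx' : x' ∈ maximalIdeal R) (hxx' : IsRegularMod (I ⊔ Ideal.span {x}) x')
    (hyI : IsRegularMod I y) :
    ∃ z ∈ maximalIdeal R, IsRegularMod (I ⊔ Ideal.span {y}) z := by
  by_contra! hcon
  have hfin := associatedPrimes.finite R (R ⧸ (I ⊔ Ideal.span {y}))
  obtain ⟨P, hP, hle⟩ := (Ideal.subset_union_prime_finite hfin (f := id) ⊥ ⊥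
    (I := maximalIdeal R) (fun P hP _ _ => hP.isPrime)).1 (by
    intro z hz
    obtain ⟨P, hP, h⟩ := not_isRegularMod_iff.1 (hcon z hz)
    exact Set.mem_biUnion hP h)
  obtain ⟨hp, w, hw⟩ := mem_associatedPrimes_quotient_iff.1 hP
  obtain ⟨w', hw'⟩ := mem_sup_span_singleton_iff.1 ((hw x).1 (hle hx))
  have key : x' * w' ∈ I ⊔ Ideal.span {x} := by
    obtain ⟨v, hv⟩ := mem_sup_span_singleton_iff.1 ((hw x').1 (hle hx'))
    refine mem_sup_span_singleton_iff.2 ⟨v, hyI _ ?_⟩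
    convert I.sub_mem (I.mul_mem_left x hv) (I.mul_mem_left x' hw') using 1
    ring
  obtain ⟨v, hv⟩ := mem_sup_span_singleton_iff.1 (hxx' _ key)
  refine hp.ne_top ((Ideal.eq_top_iff_one _).2 ((hw 1).2 ?_))
  rw [one_mul]
  refine mem_sup_span_singleton_iff.2 ⟨v, hxI _ ?_⟩
  convert I.add_mem hw' (I.mul_mem_left y hv) using 1
  ring

theorem DepthGE.sup_span_singleton {t : ℕ} {I : Ideal R} {y : R} (h : DepthGE (t + 1) I)
    (hy : y ∈ maximalIdeal R) (hyI : IsRegularMod I y) : DepthGE t (I ⊔ Ideal.span {y}) := by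
  induction t generalizing I y with
  | zero => trivial
  | succ t ih =>
    obtain ⟨x, hx, hxI, hxd⟩ := h
    obtain ⟨x', hx', hxx', -⟩ := id hxd
    obtain ⟨z', hz', hyz'⟩ := exists_isRegularMod_sup_span_singleton hxI hx hx' hxx' hyI
    obtain ⟨z, hz, hxz, hyz⟩ := exists_isRegularMod_of_mem_maximalIdeal hx' hxx' hz' hyz'
    have hzI : DepthGE (t + 1) (I ⊔ Ideal.span {z}) :=
      ⟨x, hx, hxI.sup_swap hxz, by simpa [sup_right_comm] using ih hxd hz hxz⟩
    exact ⟨z, hz, hyz, by simpa [sup_right_comm] using ih hzI hy (hyI.sup_swap hyz)⟩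

theorem DepthGE.le_ringKrullDim {t : ℕ} {I P : Ideal R} (h : DepthGE t I)
    (hP : P ∈ associatedPrimes R (R ⧸ I)) : (t : WithBot ℕ∞) ≤ ringKrullDim (R ⧸ P) := by
  induction t generalizing I P with
  | zero =>
    have : P.IsPrime := hP.isPrime
    exact_mod_cast ringKrullDim_nonneg_of_nontrivial
  | succ t ih =>
    obtain ⟨x, hx, hxI, hxd⟩ := h
    obtain ⟨hp, w, hw⟩ := mem_associatedPrimes_quotient_iff.1 hP
    have hwI : w ∉ I := fun h => hp.ne_top ((Ideal.eq_top_iff_one _).2 ((hw 1).2 (by simpa)))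
    obtain ⟨u, hu, hux⟩ : ∃ u, (∀ p ∈ P, p * u ∈ I) ∧ u ∉ I ⊔ Ideal.span {x} := by
      by_contra! hcon
      let K : Ideal R := ⨅ p ∈ P, Submodule.comap (LinearMap.mulLeft R p) I
      have hK : ∀ u, u ∈ K ↔ ∀ p ∈ P, p * u ∈ I := by
        intro u
        simp [K, Submodule.mem_iInf]
      refine hwI (le_of_le_sup_mul_of_mem_maximalIdeal (K := K) hx (fun u hu => ?_)
        ((hK w).2 fun p => (hw p).1))
      rw [hK] at hu
      obtain ⟨v, hv⟩ := mem_sup_span_singleton_iff.1 (hcon u hu)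
      refine ⟨v, (hK v).2 fun p hp => hxI _ ?_, hv⟩
      convert I.sub_mem (hu p hp) (I.mul_mem_left p hv) using 1
      ring
    obtain ⟨Q, hQ, hQu⟩ := exists_mem_associatedPrimes_quotient hux
    have hPQ : P ≤ Q := fun p hp => hQu p (le_sup_left (a := I) (hu p hp))
    have hxQ : x ∈ Q := hQu x (mem_sup_span_singleton_iff.2 ⟨u, by simp⟩)
    have hxP : x ∉ P := fun h => hwI (hxI w ((hw x).1 h))
    push_cast
    refine (add_le_add_left (ih hxd hQ) 1).trans ?_
    refine ringKrullDim_succ_le_of_surjective (Ideal.Quotient.factor hPQ)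
      (Ideal.Quotient.factor_surjective hPQ) (r := Ideal.Quotient.mk P x) ?_ ?_
    · rwa [mem_nonZeroDivisors_iff_ne_zero, Ne, Ideal.Quotient.eq_zero_iff_mem]
    · rw [Ideal.Quotient.factor_mk, Ideal.Quotient.eq_zero_iff_mem]
      exact hxQ

theorem ringKrullDim_quotient_le_card {ι : Type*} (b : ι → R) (s : Set ι) (t : Finset ι)
    {P : Ideal R} [P.IsPrime] (hst : ∀ i, i ∈ s ∨ i ∈ t) (hs : ∀ i ∈ s, b i ∈ P)
    (hrad : (Ideal.span (Set.range b)).radical = maximalIdeal R) :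
    ringKrullDim (R ⧸ P) ≤ t.card := by
  classical
  have : IsLocalRing (R ⧸ P) := .of_surjective' _ Ideal.Quotient.mk_surjective
  have hcomap : (maximalIdeal (R ⧸ P)).comap (Ideal.Quotient.mk P) = maximalIdeal R :=
    eq_maximalIdeal (Ideal.comap_isMaximal_of_surjective _ Ideal.Quotient.mk_surjective)
  rw [← maximalIdeal_height_eq_ringKrullDim]
  have hmin : maximalIdeal (R ⧸ P) ∈
      (Ideal.span ((t.image fun i => Ideal.Quotient.mk P (b i) : Finset (R ⧸ P)) :
        Set (R ⧸ P))).minimalPrimes := by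
    refine ⟨⟨inferInstance, ?_⟩, ?_⟩
    · rw [Ideal.span_le]
      intro y hy
      simp only [Finset.coe_image, Set.mem_image] at hy
      obtain ⟨i, -, rfl⟩ := hy
      change b i ∈ (maximalIdeal (R ⧸ P)).comap (Ideal.Quotient.mk P)
      rw [hcomap, ← hrad]
      exact Ideal.le_radical (Ideal.subset_span ⟨i, rfl⟩)
    · rintro Q ⟨hQ, hle⟩ -
      have : maximalIdeal R ≤ Q.comap (Ideal.Quotient.mk P) := by
        rw [← hrad, (hQ.comap _).radical_le_iff, Ideal.span_le]
        rintro _ ⟨i, rfl⟩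
        rcases hst i with hi | hi
        · simp [Ideal.Quotient.eq_zero_iff_mem.2 (hs i hi)]
        · exact hle (Ideal.subset_span (by simpa using ⟨i, hi, rfl⟩))
      intro y hy
      obtain ⟨y, rfl⟩ := Ideal.Quotient.mk_surjective y
      rw [← hcomap] at this
      exact this hy
  have := (Ideal.height_le_card_of_mem_minimalPrimes_span_finset hmin).trans
    (Nat.cast_le.2 Finset.card_image_le)
  exact_mod_cast this

theorem depthGE_span_image {ι : Type*} [Fintype ι] (b : ι → R)
    (hdepth : DepthGE (Fintype.card ι) (⊥ : Ideal R))
    (hrad : (Ideal.span (Set.range b)).radical = maximalIdeal R) (s : Finset ι) :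
    DepthGE (Fintype.card ι - s.card) (Ideal.span (b '' s)) ∧
      ∀ i ∉ s, IsRegularMod (Ideal.span (b '' s)) (b i) := by
  classical
  have hreg : ∀ s : Finset ι, DepthGE (Fintype.card ι - s.card) (Ideal.span (b '' s)) →
      ∀ i ∉ s, IsRegularMod (Ideal.span (b '' s)) (b i) := by
    intro s hs i hi
    by_contra hcon
    obtain ⟨P, hP, hbP⟩ := not_isRegularMod_iff.1 hcon
    have hp : P.IsPrime := hP.isPrime
    have h1 := hs.le_ringKrullDim hP
    obtain ⟨-, w, hw⟩ := mem_associatedPrimes_quotient_iff.1 hP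
    have h2 := ringKrullDim_quotient_le_card b (insert i s : Finset ι) (insert i s)ᶜ (P := P)
      (fun j => by simpa using em (j = i ∨ j ∈ s)) (fun j hj => by
        rcases Finset.mem_insert.1 hj with rfl | hj
        · exact hbP
        · exact (hw _).2 (Ideal.mul_mem_right _ _ (Ideal.subset_span ⟨j, hj, rfl⟩))) hrad
    have h3 := h1.trans h2
    rw [Finset.card_compl, Finset.card_insert_of_notMem hi] at h3
    have h4 : Fintype.card ι - s.card ≤ Fintype.card ι - (s.card + 1) := by exact_mod_cast h3
    have h5 := Finset.card_lt_univ_of_notMem hi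
    omega
  refine ⟨?_, hreg s ?_⟩ <;>
  · induction s using Finset.induction_on with
    | empty => simpa using hdepth
    | insert i s hi ih =>
      have h5 := Finset.card_lt_univ_of_notMem hi
      rw [Finset.card_insert_of_notMem hi, Finset.coe_insert, Set.image_insert_eq,
        Ideal.span_insert, sup_comm]
      refine DepthGE.sup_span_singleton ?_ ?_ (hreg s ih i hi)
      · rwa [show Fintype.card ι - (s.card + 1) + 1 = Fintype.card ι - s.card by omega]
      · rw [← hrad]
        exact Ideal.le_radical (Ideal.subset_span ⟨i, rfl⟩)

end LocalAlgebra

section Determinant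

variable {R : Type*} [CommRing R] {ι : Type*} [Fintype ι] [DecidableEq ι]

theorem det_mul_mem_of_mulVec_mem (I : Ideal R) (A : Matrix ι ι R) (b : ι → R)
    (h : ∀ i, A.mulVec b i ∈ I) (j : ι) : A.det * b j ∈ I := by
  have h1 : A.adjugate.mulVec (A.mulVec b) j = A.det * b j := by
    rw [Matrix.mulVec_mulVec, Matrix.adjugate_mul, Matrix.smul_mulVec, Matrix.one_mulVec]
    rfl
  rw [← h1]
  exact I.sum_mem fun i _ => I.mul_mem_left _ (h i)

theorem det_sub_det_mem_span {b y : ι → R}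
    (hy : ∀ i, IsRegularMod (Ideal.span (y '' {i}ᶜ)) (y i)) {C C' : Matrix ι ι R}
    (hC : C.mulVec b = y) (hC' : C'.mulVec b = y) :
    C.det - C'.det ∈ Ideal.span (Set.range y) := by
  have hCi : ∀ i, ∑ j, C i j * b j = y i := fun i => congrFun hC i
  have hCi' : ∀ i, ∑ j, C' i j * b j = y i := fun i => congrFun hC' i
  let M : Finset ι → Matrix ι ι R := fun s => Matrix.of fun i j => if i ∈ s then C i j else C' i j
  have hMrow : ∀ s i, ∑ j, M s i j * b j = y i := by
    intro s i
    by_cases hi : i ∈ s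
    · simpa [M, hi] using hCi i
    · simpa [M, hi] using hCi' i
  suffices ∀ s, (M s).det - C'.det ∈ Ideal.span (Set.range y) by
    have h := this Finset.univ
    rwa [show M Finset.univ = C by ext; simp [M]] at h
  intro s
  induction s using Finset.induction_on with
  | empty => simp [show M ∅ = C' by ext; simp [M]]
  | insert i s hi ih =>
    have h1 : M (insert i s) = (M s).updateRow i (C i) := by
      ext k l
      by_cases hk : k = i
      · subst hk; simp [M, Matrix.updateRow_apply]
      · simp [M, hk, Matrix.updateRow_apply]
    have h2 : M s = (M s).updateRow i (C' i) := by
      ext k l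
      by_cases hk : k = i
      · subst hk; simp [M, hi, Matrix.updateRow_apply]
      · simp [M, hk, Matrix.updateRow_apply]
    let E := (M s).updateRow i (C i - C' i)
    have h3 : (M (insert i s)).det = (M s).det + E.det := by
      have := Matrix.det_updateRow_add (M s) i (C' i) (C i - C' i)
      rwa [add_sub_cancel, ← h1, ← h2] at this
    rw [h3, add_sub_right_comm]
    refine Ideal.add_mem _ ih (Ideal.span_mono (Set.image_subset_range y {i}ᶜ) (hy i _ ?_))
    have hE : ∀ j, E.det * b j ∈ Ideal.span (y '' {i}ᶜ) := by
      refine det_mul_mem_of_mulVec_mem _ _ _ fun k => ?_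
      by_cases hk : k = i
      · subst hk
        have : E.mulVec b k = 0 := by
          simp [Matrix.mulVec, dotProduct, E, sub_mul, hCi, hCi']
        rw [this]
        exact Ideal.zero_mem _
      · have : E.mulVec b k = y k := by
          simp only [Matrix.mulVec, dotProduct, E, Matrix.updateRow_apply, if_neg hk, hMrow]
        rw [this]
        exact Ideal.subset_span ⟨k, hk, rfl⟩
    rw [← hCi i, Finset.sum_mul]
    refine Ideal.sum_mem _ fun j _ => ?_
    rw [mul_assoc, mul_comm (b j)]
    exact Ideal.mul_mem_left _ _ (hE j)

theorem mem_span_of_prod_pow_mul_mem {b : ι → R}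
    (hb : ∀ e : ι → ℕ, (∀ i, 1 ≤ e i) → ∀ i,
      IsRegularMod (Ideal.span ((fun l => b l ^ e l) '' {i}ᶜ)) (b i))
    (t : ℕ) {u : R}
    (hu : (∏ i, b i ^ t) * u ∈ Ideal.span (Set.range fun i => b i ^ (t + 1))) :
    u ∈ Ideal.span (Set.range b) := by
  let e : Finset ι → ι → ℕ := fun s i => if i ∈ s then 1 else t + 1
  have he : ∀ s i, 1 ≤ e s i := by
    intro s i
    simp only [e]
    split_ifs <;> omega
  have hsplit : ∀ (e : ι → ℕ) (i : ι), Ideal.span (Set.range fun l => b l ^ e l) =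
      Ideal.span ((fun l => b l ^ e l) '' {i}ᶜ) ⊔ Ideal.span {b i ^ e i} := by
    intro e i
    rw [sup_comm, ← Ideal.span_insert, ← Set.image_insert_eq (f := fun l => b l ^ e l),
      ← Set.image_univ]
    congr 2
    ext l
    simpa using em (l = i)
  suffices ∀ (s : Finset ι) (u : R),
      (∏ i ∈ s, b i ^ t) * u ∈ Ideal.span (Set.range fun i => b i ^ (t + 1)) →
      u ∈ Ideal.span (Set.range fun i => b i ^ e s i) by
    simpa [e] using this Finset.univ u hu
  intro s
  induction s using Finset.induction_on with
  | empty => intro u hu; simpa [e] using hu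
  | insert i s hi ih =>
    intro u hu
    rw [Finset.prod_insert hi, mul_comm (b i ^ t), mul_assoc] at hu
    have h1 := ih _ hu
    rw [hsplit _ i, mem_sup_span_singleton_iff] at h1
    obtain ⟨v, hv⟩ := h1
    have hcongr : (fun l => b l ^ e (insert i s) l) '' {i}ᶜ = (fun l => b l ^ e s l) '' {i}ᶜ := by
      refine Set.image_congr fun l (hl : l ≠ i) => ?_
      simp [e, hl]
    rw [hsplit _ i, mem_sup_span_singleton_iff, hcongr]
    refine ⟨v, (hb (e s) (he s) i).pow t _ ?_⟩
    convert hv using 1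
    simp [e, hi]
    ring

/-- If `a = A b` with `b` a regular sequence in every order and with all positive exponents, then
`(a) : det A ⊆ (b)`. -/
theorem mem_span_of_det_mul_mem {a b : ι → R}
    (hb : ∀ e : ι → ℕ, (∀ i, 1 ≤ e i) → ∀ i,
      IsRegularMod (Ideal.span ((fun l => b l ^ e l) '' {i}ᶜ)) (b i))
    {A : Matrix ι ι R} (hA : A.mulVec b = a) (t : ℕ)
    (ht : ∀ i, b i ^ (t + 1) ∈ Ideal.span (Set.range a)) {u : R}
    (hu : A.det * u ∈ Ideal.span (Set.range a)) :
    u ∈ Ideal.span (Set.range b) := by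
  choose B hB using fun i => (Ideal.mem_span_range_iff_exists_fun.1 (ht i))
  have hB' : Matrix.mulVec (Matrix.of B) a = fun i => b i ^ (t + 1) := funext hB
  refine mem_span_of_prod_pow_mul_mem hb t ?_
  have hdiag : (Matrix.diagonal fun i => b i ^ t).mulVec b = fun i => b i ^ (t + 1) := by
    ext i
    rw [Matrix.mulVec_diagonal, pow_succ]
  have hBA : (Matrix.of B * A).mulVec b = fun i => b i ^ (t + 1) := by
    rw [← Matrix.mulVec_mulVec, hA, hB']
  have h1 := det_sub_det_mem_span (fun i => (hb (fun _ => t + 1) (by simp) i).pow (t + 1)) hBA hdiag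
  rw [Matrix.det_diagonal, Matrix.det_mul] at h1
  have h2 : (Matrix.of B).det * (A.det * u) ∈
      Ideal.span (Set.range fun i => b i ^ (t + 1)) := by
    obtain ⟨c, hc⟩ := Ideal.mem_span_range_iff_exists_fun.1 hu
    rw [← hc, Finset.mul_sum]
    refine Ideal.sum_mem _ fun j _ => ?_
    rw [mul_left_comm]
    refine Ideal.mul_mem_left _ _ (det_mul_mem_of_mulVec_mem _ _ a (fun i => ?_) j)
    rw [hB']
    exact Ideal.subset_span ⟨i, rfl⟩
  convert Ideal.sub_mem _ h2 (Ideal.mul_mem_right u _ h1) using 1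
  ring

end Determinant

section Graded

variable {σ K : Type*} [Field K]

theorem mem_idealOfVars_iff {p : MvPolynomial σ K} :
    p ∈ idealOfVars σ K ↔ constantCoeff p = 0 := by
  have h := mem_pow_idealOfVars_iff' (σ := σ) (R := K) 1 p
  rw [pow_one] at h
  rw [h, constantCoeff_eq]
  constructor
  · intro h
    exact h 0 (by simp)
  · intro h x hx
    have : x = 0 := by
      rw [← Finsupp.degree_eq_zero_iff]
      omega
    rwa [this]

theorem idealOfVars_eq_ker : idealOfVars σ K = RingHom.ker (constantCoeff (σ := σ) (R := K)) := by
  ext p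
  rw [mem_idealOfVars_iff, RingHom.mem_ker]

theorem isMaximal_idealOfVars : (idealOfVars σ K).IsMaximal := by
  rw [idealOfVars_eq_ker]
  exact RingHom.ker_isMaximal_of_surjective _ fun x => ⟨C x, by simp⟩

attribute [local instance] MvPolynomial.gradedAlgebra

theorem homogeneousComponent_mul_of_le {p q : MvPolynomial σ K} {j k : ℕ}
    (hq : q.IsHomogeneous j) (hjk : j ≤ k) :
    homogeneousComponent k (p * q) = homogeneousComponent (k - j) p * q := by
  have h := DirectSum.coe_decompose_mul_of_right_mem_of_le (homogeneousSubmodule σ K) (a := p)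
    (b := q) (i := j) (n := k) hq hjk
  simpa only [DirectSum.decompose, Equiv.coe_fn_mk, decomposition.decompose'_apply] using h

theorem isHomogeneous_span_range {ι : Type*} {b : ι → MvPolynomial σ K} {e : ι → ℕ}
    (hb : ∀ i, (b i).IsHomogeneous (e i)) :
    (Ideal.span (Set.range b)).IsHomogeneous (homogeneousSubmodule σ K) := by
  apply Ideal.homogeneous_span
  rintro _ ⟨i, rfl⟩
  exact ⟨e i, hb i⟩

theorem mem_span_range_of_mul_mem {ι : Type*} {b : ι → MvPolynomial σ K} {e : ι → ℕ}
    (hb : ∀ i, (b i).IsHomogeneous (e i)) {u s : MvPolynomial σ K} {j : ℕ}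
    (hu : u.IsHomogeneous j) (hs : s ∉ idealOfVars σ K)
    (hsu : s * u ∈ Ideal.span (Set.range b)) : u ∈ Ideal.span (Set.range b) := by
  have h := homogeneousComponent_mem_of_mem (isHomogeneous_span_range hb) hsu j
  rw [homogeneousComponent_mul_of_le hu le_rfl, Nat.sub_self, homogeneousComponent_zero] at h
  rw [mem_idealOfVars_iff, constantCoeff_eq] at hs
  have h2 := Ideal.mul_mem_left _ (C (coeff 0 s)⁻¹) h
  rwa [← mul_assoc, ← C_mul, inv_mul_cancel₀ hs, C_1, one_mul] at h2

theorem exists_isHomogeneous_sum_eq {ι : Type*} [Fintype ι] {b : ι → MvPolynomial σ K} {e : ι → ℕ}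
    (hb : ∀ i, (b i).IsHomogeneous (e i)) {v : MvPolynomial σ K} {k : ℕ}
    (hv : v.IsHomogeneous k) (hk : ∀ i, e i ≤ k) (hmem : v ∈ Ideal.span (Set.range b)) :
    ∃ A : ι → MvPolynomial σ K, (∀ i, (A i).IsHomogeneous (k - e i)) ∧ ∑ i, A i * b i = v := by
  obtain ⟨A, hA⟩ := Ideal.mem_span_range_iff_exists_fun.mp hmem
  refine ⟨fun i => homogeneousComponent (k - e i) (A i),
    fun i => homogeneousComponent_isHomogeneous _ _, ?_⟩
  have h : homogeneousComponent k (∑ i, A i * b i) = v := by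
    rw [hA, homogeneousComponent_of_mem hv, if_pos rfl]
  rw [← h, map_sum]
  exact Finset.sum_congr rfl fun i _ => (homogeneousComponent_mul_of_le (hb i) (hk i)).symm

theorem mem_span_X_pow_of_isHomogeneous [Fintype σ] {w : MvPolynomial σ K} {j k : ℕ}
    (hw : w.IsHomogeneous j) (hj : Fintype.card σ * (k - 1) < j) :
    w ∈ Ideal.span (Set.range fun i : σ => (X i : MvPolynomial σ K) ^ k) := by
  have h : (Set.range fun i : σ => (X i : MvPolynomial σ K) ^ k) =
      (fun s => monomial s (1 : K)) '' Set.range fun i : σ => Finsupp.single i k := by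
    ext
    simp [X_pow_eq_monomial]
  rw [h, mem_ideal_span_monomial_image]
  intro x hx
  have hdeg : x.degree = j := by
    rw [← hw (mem_support_iff.mp hx), Finsupp.degree_eq_weight_one]
    rfl
  by_contra! hcon
  have h2 : ∀ i, x i ≤ k - 1 := by
    intro i
    by_contra! hi
    apply hcon _ ⟨i, rfl⟩
    rw [Finsupp.single_le_iff]
    omega
  have h3 : x.degree ≤ Fintype.card σ * (k - 1) := by
    rw [Finsupp.degree_eq_sum]
    calc ∑ i, x i ≤ ∑ _i : σ, (k - 1) := Finset.sum_le_sum fun i _ => h2 i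
      _ = _ := by simp
  omega

theorem isRegularMod_span_X_image [Fintype σ] {s : Set σ} {i : σ} (hi : i ∉ s) :
    IsRegularMod (Ideal.span ((X : σ → MvPolynomial σ K) '' s)) (X i) := by
  intro z hz
  rw [mem_ideal_span_X_image] at hz ⊢
  intro x hx
  obtain ⟨l, hl, hl2⟩ := hz (Finsupp.single i 1 + x) (by
    rw [mem_support_iff, add_comm, mul_comm, coeff_mul_X]
    exact mem_support_iff.mp hx)
  refine ⟨l, hl, ?_⟩
  have : i ≠ l := fun h => hi (h ▸ hl)
  simpa [Finsupp.single_apply, this] using hl2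

end Graded

section Localization

open IsLocalRing

theorem IsRegularMod.map_localization {A B : Type*} [CommRing A] [CommRing B] [Algebra A B]
    (M : Submonoid A) [IsLocalization M B] {I : Ideal A} {x : A} (h : IsRegularMod I x) :
    IsRegularMod (I.map (algebraMap A B)) (algebraMap A B x) := by
  intro z hz
  obtain ⟨y, s, rfl⟩ := IsLocalization.exists_mk'_eq M z
  rw [IsLocalization.mul_mk'_eq_mk'_of_mul, IsLocalization.mk'_mem_map_algebraMap_iff] at hz
  rw [IsLocalization.mk'_mem_map_algebraMap_iff]
  obtain ⟨t, ht, htx⟩ := hz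
  refine ⟨t, ht, h _ ?_⟩
  convert htx using 1
  ring

theorem radical_span_range_pow {A ι : Type*} [CommRing A] (b : ι → A) (e : ι → ℕ)
    (he : ∀ i, 1 ≤ e i) :
    (Ideal.span (Set.range fun i => b i ^ e i)).radical = (Ideal.span (Set.range b)).radical := by
  apply le_antisymm
  · apply Ideal.radical_mono
    rw [Ideal.span_le]
    rintro _ ⟨i, rfl⟩
    exact Ideal.pow_mem_of_mem _ (Ideal.subset_span (Set.mem_range_self i)) _ (he i)
  · rw [Ideal.radical_le_radical_iff, Ideal.span_le]
    rintro _ ⟨i, rfl⟩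
    exact Ideal.mem_radical_iff.mpr ⟨e i, Ideal.subset_span ⟨i, rfl⟩⟩

theorem depthGE_bot (σ K : Type*) [Fintype σ] [Field K] (L : Type*) [CommRing L] [IsLocalRing L]
    [Algebra (MvPolynomial σ K) L] [(idealOfVars σ K).IsPrime]
    [IsLocalization.AtPrime L (idealOfVars σ K)] :
    DepthGE (Fintype.card σ) (⊥ : Ideal L) := by
  classical
  let x : σ → L := fun i => algebraMap (MvPolynomial σ K) L (X i)
  suffices ∀ (k : ℕ) (s : Finset σ), s.card + k = Fintype.card σ →
      DepthGE k (Ideal.span (x '' s)) by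
    simpa using this (Fintype.card σ) ∅ (by simp)
  intro k
  induction k with
  | zero => exact fun _ _ => trivial
  | succ k ih =>
    intro s hs
    obtain ⟨i, hi⟩ : ∃ i, i ∉ s := by
      by_contra! h
      rw [← Finset.card_univ, ← Finset.eq_univ_iff_forall.mpr h] at hs
      omega
    refine ⟨x i, ?_, ?_, ?_⟩
    · rw [IsLocalization.AtPrime.to_map_mem_maximal_iff L (idealOfVars σ K)]
      exact Ideal.subset_span ⟨i, rfl⟩
    · have h := (isRegularMod_span_X_image (K := K) (s := (s : Set σ)) hi).map_localization (B := L)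
        (idealOfVars σ K).primeCompl
      rwa [Ideal.map_span, Set.image_image] at h
    · have h := ih (insert i s) (by rw [Finset.card_insert_of_notMem hi]; omega)
      rwa [Finset.coe_insert, Set.image_insert_eq, Ideal.span_insert, sup_comm] at h

variable {σ K : Type*} [Field K] (L : Type*) [CommRing L]
  [Algebra (MvPolynomial σ K) L] [hprime : (idealOfVars σ K).IsPrime]
  [IsLocalization.AtPrime L (idealOfVars σ K)]

theorem mem_span_range_of_algebraMap_mem {ι : Type*} {b : ι → MvPolynomial σ K} {e : ι → ℕ}
    (hb : ∀ i, (b i).IsHomogeneous (e i)) {u : MvPolynomial σ K} {j : ℕ}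
    (hu : u.IsHomogeneous j)
    (h : algebraMap _ L u ∈ Ideal.span (Set.range fun i => algebraMap _ L (b i))) :
    u ∈ Ideal.span (Set.range b) := by
  rw [Set.range_comp' (algebraMap _ L) b, ← Ideal.map_span,
    IsLocalization.algebraMap_mem_map_algebraMap_iff (idealOfVars σ K).primeCompl] at h
  obtain ⟨s, hs, hsu⟩ := h
  exact mem_span_range_of_mul_mem hb hu hs hsu

variable [IsLocalRing L]

theorem mem_span_range_of_radical_eq [Fintype σ] [Nonempty σ] [IsNoetherianRing L]
    {b : σ → MvPolynomial σ K} {e : σ → ℕ} (hb : ∀ i, (b i).IsHomogeneous (e i))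
    (hrad : (Ideal.span (Set.range fun i => algebraMap _ L (b i))).radical = maximalIdeal L)
    {u : MvPolynomial σ K} {N : ℕ} (hu : u.IsHomogeneous N)
    (hN : ∑ i, e i < N + Fintype.card σ) : u ∈ Ideal.span (Set.range b) := by
  classical
  have hcard : 0 < Fintype.card σ := Fintype.card_pos
  obtain ⟨T, hT⟩ := Ideal.exists_radical_pow_le_of_fg
    (Ideal.span (Set.range fun i => algebraMap _ L (b i))) (IsNoetherian.noetherian _)
  rw [hrad] at hT
  set k := T + ∑ i, e i + 1 with hk
  have hek : ∀ i, e i ≤ k := fun i =>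
    (Finset.single_le_sum (f := e) (fun _ _ => Nat.zero_le _) (Finset.mem_univ i)).trans (by omega)
  have hXm : ∀ i : σ, algebraMap (MvPolynomial σ K) L (X i) ∈ maximalIdeal L := by
    intro i
    rw [IsLocalization.AtPrime.to_map_mem_maximal_iff L (idealOfVars σ K)]
    exact Ideal.subset_span ⟨i, rfl⟩
  have hX : ∀ i : σ, (X i : MvPolynomial σ K) ^ k ∈ Ideal.span (Set.range b) := by
    intro i
    refine mem_span_range_of_algebraMap_mem L hb (isHomogeneous_X_pow i k) (hT ?_)
    rw [map_pow]
    exact Ideal.pow_le_pow_right (by omega) (Ideal.pow_mem_pow (hXm i) k)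
  choose A hAh hA using fun i => exists_isHomogeneous_sum_eq hb (isHomogeneous_X_pow i k) hek (hX i)
  have hdet : ((Matrix.of A).det).IsHomogeneous (∑ j, (k - e j)) := by
    rw [Matrix.det_apply]
    refine IsHomogeneous.sum _ _ _ fun τ _ => ?_
    rw [← mem_homogeneousSubmodule]
    refine (homogeneousSubmodule σ K _).toAddSubgroup.zsmul_mem ?_ _
    exact IsHomogeneous.prod _ _ _ fun j _ => hAh (τ j) j
  have hsum : ∑ j, (k - e j) + ∑ j, e j = Fintype.card σ * k := by
    rw [← Finset.sum_add_distrib]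
    simp [Nat.sub_add_cancel (hek _)]
  have hmem := mem_span_X_pow_of_isHomogeneous (k := k) (hdet.mul hu) (by
    have : Fintype.card σ * k = Fintype.card σ * (k - 1) + Fintype.card σ := by
      rw [hk, Nat.add_sub_cancel]
      ring
    omega)
  refine mem_span_range_of_algebraMap_mem L hb hu ?_
  have hreg : ∀ r : σ → ℕ, (∀ i, 1 ≤ r i) → ∀ i, IsRegularMod
      (Ideal.span ((fun l => algebraMap _ L (b l) ^ r l) '' {i}ᶜ)) (algebraMap _ L (b i)) := by
    intro r hr i
    let b' : σ → L := fun l => algebraMap _ L (b l) ^ Function.update r i 1 l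
    have h := (depthGE_span_image b' (depthGE_bot σ K L) (by
      rw [← hrad]
      refine radical_span_range_pow (fun l => algebraMap _ L (b l)) _ fun l => ?_
      by_cases hl : l = i
      · simp [hl]
      · simpa [hl] using hr l) (Finset.univ.erase i)).2 i (by simp)
    have hi : b' i = algebraMap _ L (b i) := by simp [b']
    have himg : b' '' (Finset.univ.erase i : Finset σ) =
        (fun l => algebraMap _ L (b l) ^ r l) '' {i}ᶜ := by
      rw [Finset.coe_erase, Finset.coe_univ, ← Set.compl_eq_univ_sdiff]
      refine Set.image_congr fun l (hl : l ≠ i) => ?_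
      simp [b', hl]
    rwa [hi, himg] at h
  have hXrad : (Ideal.span
      (Set.range fun i : σ => algebraMap (MvPolynomial σ K) L (X i ^ k))).radical =
      maximalIdeal L := by
    simp only [map_pow]
    rw [radical_span_range_pow _ (fun _ => k) fun _ => by omega,
      Set.range_comp' (algebraMap _ L) X, ← Ideal.map_span,
      IsLocalization.AtPrime.map_eq_maximalIdeal (idealOfVars σ K) L]
    exact (maximalIdeal.isMaximal L).isPrime.radical
  obtain ⟨t, ht⟩ := Ideal.exists_radical_pow_le_of_fg (Ideal.span
      (Set.range fun i : σ => algebraMap (MvPolynomial σ K) L (X i ^ k)))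
      (IsNoetherian.noetherian _)
  rw [hXrad] at ht
  have hbm : ∀ i, algebraMap _ L (b i) ∈ maximalIdeal L := fun i => by
    rw [← hrad]
    exact Ideal.le_radical (Ideal.subset_span ⟨i, rfl⟩)
  refine mem_span_of_det_mul_mem (a := fun i : σ => algebraMap (MvPolynomial σ K) L (X i ^ k)) hreg
    (A := (algebraMap (MvPolynomial σ K) L).mapMatrix (Matrix.of A)) ?_ t ?_ ?_
  · ext i
    rw [← hA i, map_sum]
    simp [Matrix.mulVec, dotProduct]
  · intro i
    refine ht (Ideal.pow_le_pow_right (by omega) (Ideal.pow_mem_pow (hbm i) (t + 1)))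
  · rw [← RingHom.map_det, ← map_mul,
      Set.range_comp' (algebraMap (MvPolynomial σ K) L) fun i : σ => X i ^ k, ← Ideal.map_span]
    exact Ideal.mem_map_of_mem _ hmem

end Localization

section GenericElements

open IsLocalRing

variable {L : Type*} [CommRing L]

theorem ringKrullDim_quotient_sup_span_singleton_le {H : Ideal L} {x : L} {t : ℕ}
    (hx : ∀ P ∈ H.minimalPrimes, x ∉ P) (ht : ringKrullDim (L ⧸ H) ≤ (t + 1 : ℕ)) :
    ringKrullDim (L ⧸ (H ⊔ Ideal.span {x})) ≤ t := by
  rw [ringKrullDim_quotient] at ht ⊢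
  refine iSup_le fun p => ?_
  have hsub : PrimeSpectrum.zeroLocus ((H ⊔ Ideal.span {x} : Ideal L) : Set L) ⊆
      PrimeSpectrum.zeroLocus (H : Set L) :=
    PrimeSpectrum.zeroLocus_anti_mono (le_sup_left : H ≤ H ⊔ Ideal.span {x})
  have hmem : H ⊔ Ideal.span {x} ≤ p.head.1.asIdeal := p.head.2
  obtain ⟨Q, hQ, hQp⟩ := Ideal.exists_minimalPrimes_le (le_sup_left.trans hmem)
  have hne : Q ≠ p.head.1.asIdeal := by
    rintro rfl
    exact hx _ hQ (hmem (Ideal.mem_sup_right (Ideal.mem_span_singleton_self x)))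
  let Q' : PrimeSpectrum.zeroLocus (H : Set L) := ⟨⟨Q, hQ.1.1⟩, hQ.1.2⟩
  have hlt : Q' < Set.inclusion hsub p.head := lt_of_le_of_ne hQp fun h => hne
    (congrArg (fun y : PrimeSpectrum.zeroLocus (H : Set L) => y.1.asIdeal) h)
  let q : LTSeries (PrimeSpectrum.zeroLocus (H : Set L)) :=
    (p.map (Set.inclusion hsub) (fun _ _ h => h)).cons Q' hlt
  have h1 : ((q.length : ℕ) : WithBot ℕ∞) ≤ ((t + 1 : ℕ) : WithBot ℕ∞) :=
    le_trans (le_iSup (fun r : LTSeries (PrimeSpectrum.zeroLocus (H : Set L)) =>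
      ((r.length : ℕ) : WithBot ℕ∞)) q) ht
  have h2 : q.length = p.length + 1 := by
    simp [q, RelSeries.cons, LTSeries.map, RelSeries.append, RelSeries.singleton]
  rw [h2] at h1
  have h3 : p.length + 1 ≤ t + 1 := by exact_mod_cast h1
  exact_mod_cast Nat.le_of_succ_le_succ h3

variable [IsLocalRing L]

theorem radical_eq_maximalIdeal_of_ringKrullDim_le_zero {H : Ideal L} (hH : H ≤ maximalIdeal L)
    (h : ringKrullDim (L ⧸ H) ≤ 0) : H.radical = maximalIdeal L := by
  have h1 := Ideal.krullDimLE_zero_quotient_iff_forall_minimalPrimes_isMaximal.mp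
    (Ring.krullDimLE_iff.mpr (by exact_mod_cast h) : Ring.KrullDimLE 0 (L ⧸ H))
  refine le_antisymm ((maximalIdeal.isMaximal L).isPrime.radical_le_iff.mpr hH) ?_
  rw [Ideal.radical_eq_sInf]
  refine le_sInf fun P ⟨hHP, hP⟩ => ?_
  obtain ⟨Q, hQ, hQP⟩ := Ideal.exists_minimalPrimes_le hHP
  exact (eq_maximalIdeal (h1 Q hQ)).ge.trans hQP

/-- Over an infinite field, a general choice of `t` elements of a vector space `V` cuts down the
dimension of `L ⧸ H` to zero, provided `H` and `V` have no common zero but the closed point. -/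
theorem exists_radical_sup_span_range_eq_maximalIdeal [IsNoetherianRing L] {K A : Type*} [Field K]
    [Infinite K] [CommRing A] [Algebra K A] (φ : A →+* L) (V : Submodule K A)
    (hV : ∀ v ∈ V, φ v ∈ maximalIdeal L) (t : ℕ) (H : Ideal L) (hH : H ≤ maximalIdeal L)
    (hVH : ∀ P : Ideal L, P.IsPrime → H ≤ P → (∀ v ∈ V, φ v ∈ P) → P = maximalIdeal L)
    (ht : ringKrullDim (L ⧸ H) ≤ t) :
    ∃ v : Fin t → A, (∀ i, v i ∈ V) ∧
      (H ⊔ Ideal.span (Set.range fun i => φ (v i))).radical = maximalIdeal L := by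
  classical
  induction t generalizing H with
  | zero =>
    refine ⟨fun i => i.elim0, fun i => i.elim0, ?_⟩
    rw [Set.range_eq_empty, Ideal.span_empty, sup_bot_eq]
    exact radical_eq_maximalIdeal_of_ringKrullDim_le_zero hH (by exact_mod_cast ht)
  | succ t ih =>
    by_cases hmin : maximalIdeal L ∈ H.minimalPrimes
    · refine ⟨fun _ => 0, fun _ => V.zero_mem, ?_⟩
      have h0 : Ideal.span (Set.range fun _ : Fin (t + 1) => φ 0) = ⊥ := by
        simp
      rw [h0, sup_bot_eq]
      refine le_antisymm ((maximalIdeal.isMaximal L).isPrime.radical_le_iff.mpr hH) ?_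
      rw [Ideal.radical_eq_sInf]
      exact le_sInf fun P hP => hmin.2 ⟨hP.2, hP.1⟩ (le_maximalIdeal hP.2.ne_top)
    · obtain ⟨v, hv, hvP⟩ : ∃ v ∈ V, ∀ P ∈ H.minimalPrimes, φ v ∉ P := by
        by_contra! hcon
        let W : Ideal L → Submodule K V := fun P =>
          ((P.comap φ).restrictScalars K).comap V.subtype
        have hfin := Ideal.finite_minimalPrimes_of_isNoetherianRing L H
        have htop := Subspace.top_mem_of_biUnion_eq_univ (s := hfin.toFinset.image W) (by
          rw [Set.eq_univ_iff_forall]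
          rintro ⟨v, hv⟩
          obtain ⟨P, hP, hvP⟩ := hcon v hv
          refine Set.mem_biUnion (x := W P) ?_ hvP
          exact Finset.mem_image_of_mem W (hfin.mem_toFinset.mpr hP))
        obtain ⟨P, hP, hPW⟩ := Finset.mem_image.mp htop
        rw [hfin.mem_toFinset] at hP
        refine hmin (hVH P hP.1.1 hP.1.2 (fun v hv => ?_) ▸ hP)
        have : (⟨v, hv⟩ : V) ∈ W P := hPW ▸ Submodule.mem_top
        exact this
      obtain ⟨w, hw, hwr⟩ := ih (H ⊔ Ideal.span {φ v})
        (sup_le hH (by simpa [Ideal.span_le] using hV v hv))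
        (fun P hP hHP => hVH P hP (le_sup_left.trans hHP))
        (ringKrullDim_quotient_sup_span_singleton_le hvP ht)
      refine ⟨Fin.cons v w, fun i => ?_, ?_⟩
      · refine Fin.cases ?_ (fun j => ?_) i
        · simpa using hv
        · simpa using hw j
      · rw [← hwr, sup_assoc, ← Ideal.span_union]
        congr 3
        ext y
        simp [Fin.exists_fin_succ, eq_comm]

end GenericElements

section InfiniteField

open IsLocalRing

variable {σ K : Type*} [Fintype σ] [Field K]

theorem ringKrullDim_localization_idealOfVars_le (L : Type*) [CommRing L] [IsLocalRing L]
    [IsNoetherianRing L] [Algebra (MvPolynomial σ K) L] [(idealOfVars σ K).IsPrime]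
    [IsLocalization.AtPrime L (idealOfVars σ K)] :
    ringKrullDim L ≤ Fintype.card σ := by
  refine (ringKrullDim_le_spanFinrank_maximalIdeal L).trans ?_
  rw [← IsLocalization.AtPrime.map_eq_maximalIdeal (idealOfVars σ K) L, Ideal.map_span,
    ← Set.range_comp]
  have h1 := Submodule.spanFinrank_span_le_ncard_of_finite (R := L)
    (Set.finite_range (algebraMap (MvPolynomial σ K) L ∘ X))
  have h2 : (Set.range (algebraMap (MvPolynomial σ K) L ∘ X)).ncard ≤ Fintype.card σ := by
    rw [← Set.image_univ, ← Nat.card_eq_fintype_card, ← Set.ncard_univ]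
    exact Set.ncard_image_le
  exact_mod_cast h1.trans h2

theorem ringKrullDim_quotient_span_range_add_le (L : Type*) [CommRing L] [IsLocalRing L]
    [IsNoetherianRing L] [Algebra (MvPolynomial σ K) L] [(idealOfVars σ K).IsPrime]
    [IsLocalization.AtPrime L (idealOfVars σ K)] {c : ℕ} {f : Fin c → MvPolynomial σ K}
    (hfm : ∀ i, f i ∈ idealOfVars σ K)
    (hreg : RingTheory.Sequence.IsRegular (MvPolynomial σ K) (List.ofFn f)) :
    c ≤ Fintype.card σ ∧
      ringKrullDim (L ⧸ Ideal.span (Set.range fun i => algebraMap (MvPolynomial σ K) L (f i))) ≤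
        (Fintype.card σ - c : ℕ) := by
  have hregL := hreg.toIsWeaklyRegular.isRegular_of_isLocalization_of_mem L (idealOfVars σ K) (by
    intro r hr
    obtain ⟨i, rfl⟩ := (List.mem_ofFn' _ _).mp hr
    exact hfm i)
  have hdim := ringKrullDim_add_length_eq_ringKrullDim_of_isRegular _ hregL
  have hlist : Ideal.ofList (List.map (algebraMap (MvPolynomial σ K) L) (List.ofFn f)) =
      Ideal.span (Set.range fun i => algebraMap (MvPolynomial σ K) L (f i)) := by
    rw [List.map_ofFn]
    unfold Ideal.ofList
    congr 1
    ext
    simp [List.mem_ofFn]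
  rw [hlist, List.length_map, List.length_ofFn] at hdim
  have hle := hdim.le.trans (ringKrullDim_localization_idealOfVars_le (σ := σ) (K := K) L)
  have htop : Ideal.span (Set.range fun i => algebraMap (MvPolynomial σ K) L (f i)) ≠ ⊤ := by
    refine ne_top_of_le_ne_top (maximalIdeal.isMaximal L).ne_top ?_
    rw [Ideal.span_le]
    rintro _ ⟨i, rfl⟩
    exact (IsLocalization.AtPrime.to_map_mem_maximal_iff L (idealOfVars σ K) _).mpr (hfm i)
  have := Ideal.Quotient.nontrivial_iff.mpr htop
  have hnn := ringKrullDim_nonneg_of_nontrivial (R := L ⧸ Ideal.span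
    (Set.range fun i => algebraMap (MvPolynomial σ K) L (f i)))
  generalize ringKrullDim (L ⧸ Ideal.span
    (Set.range fun i => algebraMap (MvPolynomial σ K) L (f i))) = x at hle hnn
  induction x with
  | bot => simp at hnn
  | coe x =>
    induction x with
    | top => exact absurd hle (by exact_mod_cast not_le.mpr (ENat.natCast_lt_top _))
    | coe x =>
      have h : x + c ≤ Fintype.card σ := by exact_mod_cast hle
      refine ⟨by omega, ?_⟩
      have h' : ((x : ℕ) : ℕ∞) ≤ (Fintype.card σ - c : ℕ) := by
        exact Nat.cast_le.mpr (Nat.le_sub_of_add_le h)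
      exact WithBot.coe_le_coe.mpr h'

theorem card_le_of_isRegular {c : ℕ} {f : Fin c → MvPolynomial σ K}
    (hfm : ∀ i, f i ∈ idealOfVars σ K)
    (hreg : RingTheory.Sequence.IsRegular (MvPolynomial σ K) (List.ofFn f)) :
    c ≤ Fintype.card σ := by
  have := (isMaximal_idealOfVars (σ := σ) (K := K)).isPrime
  exact (ringKrullDim_quotient_span_range_add_le (Localization.AtPrime (idealOfVars σ K))
    hfm hreg).1

theorem mem_span_sup_span_range_pow [Nonempty σ] [Infinite K] {c : ℕ}
    {f : Fin c → MvPolynomial σ K} {D : Fin c → ℕ} (hf : ∀ i, (f i).IsHomogeneous (D i))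
    (hreg : RingTheory.Sequence.IsRegular (MvPolynomial σ K) (List.ofFn f))
    {V : Submodule K (MvPolynomial σ K)} {q : ℕ} (hV : ∀ v ∈ V, v.IsHomogeneous q)
    (hrad : (Ideal.span (V : Set (MvPolynomial σ K)) ⊔ Ideal.span (Set.range f)).radical =
      idealOfVars σ K)
    {a : Fin c → ℕ} (ha : ∀ i, 1 ≤ a i) {u : MvPolynomial σ K} {N : ℕ} (hu : u.IsHomogeneous N)
    (hN : ∑ i, D i * a i + (Fintype.card σ - c) * q < N + Fintype.card σ) :
    u ∈ Ideal.span (V : Set (MvPolynomial σ K)) ⊔ Ideal.span (Set.range fun i => f i ^ a i) := by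
  have hprime := (isMaximal_idealOfVars (σ := σ) (K := K)).isPrime
  let L := Localization.AtPrime (idealOfVars σ K)
  let φ := algebraMap (MvPolynomial σ K) L
  have hφ : ∀ p, φ p ∈ maximalIdeal L ↔ p ∈ idealOfVars σ K :=
    fun p => IsLocalization.AtPrime.to_map_mem_maximal_iff L (idealOfVars σ K) p
  have hle := hrad ▸ Ideal.le_radical
    (I := Ideal.span (V : Set (MvPolynomial σ K)) ⊔ Ideal.span (Set.range f))
  have hfm : ∀ i, f i ∈ idealOfVars σ K := fun i =>
    hle (Ideal.mem_sup_right (Ideal.subset_span ⟨i, rfl⟩))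
  have hVm : ∀ v ∈ V, v ∈ idealOfVars σ K := fun v hv =>
    hle (Ideal.mem_sup_left (Ideal.subset_span hv))
  obtain ⟨hc, hdim⟩ := ringKrullDim_quotient_span_range_add_le L hfm hreg
  obtain ⟨g, hgV, hg⟩ := exists_radical_sup_span_range_eq_maximalIdeal φ V
    (fun v hv => (hφ v).mpr (hVm v hv)) (Fintype.card σ - c) _
    (by
      rw [Ideal.span_le]
      rintro _ ⟨i, rfl⟩
      exact (hφ _).mpr (hfm i))
    (by
      intro P hP hfP hVP
      have h1 : idealOfVars σ K ≤ P.comap φ := by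
        refine hrad.ge.trans ((hP.comap φ).radical_le_iff.mpr ?_)
        rw [sup_le_iff, Ideal.span_le, Ideal.span_le]
        refine ⟨fun v hv => hVP v hv, ?_⟩
        rintro _ ⟨i, rfl⟩
        exact hfP (Ideal.subset_span ⟨i, rfl⟩)
      refine le_antisymm (le_maximalIdeal hP.ne_top) ?_
      rw [← IsLocalization.AtPrime.map_eq_maximalIdeal (idealOfVars σ K) L]
      exact Ideal.map_le_iff_le_comap.mpr h1)
    hdim
  let b' : Fin c ⊕ Fin (Fintype.card σ - c) → MvPolynomial σ K :=
    Sum.elim (fun i => f i ^ a i) g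
  let e' : Fin c ⊕ Fin (Fintype.card σ - c) → ℕ := Sum.elim (fun i => D i * a i) fun _ => q
  have hb' : ∀ i, (b' i).IsHomogeneous (e' i) := by
    rintro (i | i)
    · exact (hf i).pow (a i)
    · exact hV _ (hgV i)
  let τ : σ ≃ Fin c ⊕ Fin (Fintype.card σ - c) := Fintype.equivOfCardEq (by simp; omega)
  have hspan : Ideal.span (Set.range (b' ∘ τ)) =
      Ideal.span (Set.range fun i => f i ^ a i) ⊔ Ideal.span (Set.range g) := by
    rw [τ.surjective.range_comp, ← Ideal.span_union, Set.Sum.elim_range]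
  have hmem := mem_span_range_of_radical_eq L (b := b' ∘ τ) (e := e' ∘ τ) (fun i => hb' (τ i)) (by
    rw [← hg, Set.range_comp' φ (b' ∘ τ), ← Ideal.map_span, hspan, Ideal.map_sup, Ideal.map_span,
      Ideal.map_span, ← Set.range_comp, ← Set.range_comp, Ideal.radical_sup]
    have h1 := radical_span_range_pow (fun i => φ (f i)) a ha
    simp only [← map_pow] at h1
    conv_rhs => rw [Ideal.radical_sup]
    rw [← h1]
    rfl) hu (by
    have h1 : ∑ i, (e' ∘ τ) i = ∑ i, e' i := Equiv.sum_comp τ e'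
    rw [h1, Fintype.sum_sum_type]
    simpa [e'] using hN)
  rw [hspan] at hmem
  refine sup_le (α := Ideal (MvPolynomial σ K)) le_sup_right (le_sup_of_le_left ?_) hmem
  rw [Ideal.span_le]
  rintro _ ⟨i, rfl⟩
  exact Ideal.subset_span (hgV i)

end InfiniteField

section BaseChange

attribute [local instance] MvPolynomial.algebraMvPolynomial

theorem faithfullyFlat_mvPolynomial (σ F K : Type*) [Field F] [Field K] [Algebra F K] :
    Module.FaithfullyFlat (MvPolynomial σ F) (MvPolynomial σ K) := by
  have h : Algebra.IsPushout F (MvPolynomial σ F) K (MvPolynomial σ K) := inferInstance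
  have : Module.Free (MvPolynomial σ F) (MvPolynomial σ K) := Module.Free.of_equiv h.out.equiv
  infer_instance

variable {σ F : Type*} [Fintype σ] [Nonempty σ] [Field F]

theorem ne_zero_of_isRegular {A : Type*} [CommRing A] {c : ℕ} {f : Fin c → A}
    (hreg : RingTheory.Sequence.IsRegular A (List.ofFn f)) (j : Fin c) : f j ≠ 0 := by
  intro h0
  have h := hreg.regular_mod_prev j (by simp)
  rw [List.getElem_ofFn] at h
  simp only [Fin.eta, h0] at h
  apply hreg.top_ne_smul
  have h1 : (⊤ : Submodule A A) ≤ Ideal.ofList ((List.ofFn f).take j) • ⊤ := by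
    intro x _
    rw [← Submodule.Quotient.mk_eq_zero]
    exact h (by simp)
  refine le_antisymm (h1.trans (Submodule.smul_mono_left ?_)) le_top
  exact Ideal.span_mono fun x hx => List.mem_of_mem_take hx

theorem isHomogeneous_det_pderiv {τ : Type*} {c : ℕ} {f : Fin c → MvPolynomial τ F}
    {D : Fin c → ℕ} (hf : ∀ i, (f i).IsHomogeneous (D i)) (r : Fin c → τ) :
    (Matrix.det (Matrix.of fun i j : Fin c => pderiv (r i) (f j))).IsHomogeneous
      (∑ j, (D j - 1)) := by
  rw [Matrix.det_apply]
  refine IsHomogeneous.sum _ _ _ fun τ _ => ?_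
  rw [← mem_homogeneousSubmodule]
  refine (homogeneousSubmodule _ F _).toAddSubgroup.zsmul_mem ?_ _
  exact IsHomogeneous.prod _ _ _ fun j _ => (hf j).pderiv

theorem mem_span_sup_span_range_pow_of_field {c : ℕ} {f : Fin c → MvPolynomial σ F}
    {D : Fin c → ℕ} (hf : ∀ i, (f i).IsHomogeneous (D i))
    (hreg : RingTheory.Sequence.IsRegular (MvPolynomial σ F) (List.ofFn f))
    {G : Set (MvPolynomial σ F)} {q : ℕ} (hG : ∀ g ∈ G, g.IsHomogeneous q)
    (hrad : (Ideal.span G ⊔ Ideal.span (Set.range f)).radical = idealOfVars σ F)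
    {a : Fin c → ℕ} (ha : ∀ i, 1 ≤ a i) {u : MvPolynomial σ F} {N : ℕ} (hu : u.IsHomogeneous N)
    (hN : ∑ i, D i * a i + (Fintype.card σ - c) * q < N + Fintype.card σ) :
    u ∈ Ideal.span G ⊔ Ideal.span (Set.range fun i => f i ^ a i) := by
  let K := AlgebraicClosure F
  have : Infinite K := IsAlgClosed.instInfinite
  have := faithfullyFlat_mvPolynomial σ F K
  let φ := algebraMap (MvPolynomial σ F) (MvPolynomial σ K)
  have hφ : ∀ {p : MvPolynomial σ F} {j : ℕ}, p.IsHomogeneous j → (φ p).IsHomogeneous j :=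
    fun h => h.map _
  have hφm : (idealOfVars σ F).map φ = idealOfVars σ K := by
    rw [idealOfVars, Ideal.map_span, ← Set.range_comp]
    congr 2
    ext1 i
    exact map_X _ i
  have hspan : Ideal.span ((Submodule.span K (φ '' G) : Submodule K (MvPolynomial σ K)) :
      Set (MvPolynomial σ K)) = (Ideal.span G).map φ := by
    rw [Ideal.map_span]
    refine le_antisymm (Ideal.span_le.mpr ?_) (Ideal.span_mono Submodule.subset_span)
    have : Submodule.span K (φ '' G) ≤ (Ideal.span (φ '' G)).restrictScalars K :=
      Submodule.span_le.mpr Ideal.subset_span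
    exact this
  have hV : ∀ v ∈ Submodule.span K (φ '' G), v.IsHomogeneous q := by
    have : Submodule.span K (φ '' G) ≤ homogeneousSubmodule σ K q := by
      rw [Submodule.span_le]
      rintro _ ⟨g, hg, rfl⟩
      exact hφ (hG g hg)
    exact this
  have hregK := hreg.of_faithfullyFlat (S := MvPolynomial σ K)
  rw [List.map_ofFn] at hregK
  have hradK : (Ideal.span ((Submodule.span K (φ '' G) : Submodule K (MvPolynomial σ K)) :
      Set (MvPolynomial σ K)) ⊔ Ideal.span (Set.range (φ ∘ f))).radical = idealOfVars σ K := by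
    rw [hspan, Set.range_comp, ← Ideal.map_span, ← Ideal.map_sup]
    apply le_antisymm
    · rw [isMaximal_idealOfVars.isPrime.radical_le_iff, ← hφm, ← hrad]
      exact Ideal.map_mono Ideal.le_radical
    · rw [← hφm, ← hrad]
      exact Ideal.map_radical_le φ
  have hmem := mem_span_sup_span_range_pow (fun i => hφ (hf i)) hregK hV hradK ha (hφ hu) hN
  rw [hspan] at hmem
  have hpow : Ideal.span (Set.range fun i => φ (f i) ^ a i) =
      (Ideal.span (Set.range fun i => f i ^ a i)).map φ := by
    rw [Ideal.map_span, ← Set.range_comp]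
    congr 2
    ext1 i
    exact (map_pow φ _ _).symm
  rw [hpow, ← Ideal.map_sup, ← Ideal.mem_comap,
    Ideal.comap_map_eq_self_of_faithfullyFlat] at hmem
  exact hmem

end BaseChange

/-- **Claim inside the proof of Theorem 4.1.** Let `S = F[x_0, …, x_n]`, let
`f_1, …, f_c` be a regular sequence of homogeneous forms of degrees `d_1, …, d_c`,
`d := Σ d_i`, and let `J` be the ideal of `c × c` minors of the Jacobian matrix.  Assume
`J + (f_1, …, f_c)` is `m`-primary.  Then for all positive integers `a_1 = 1, a_2, …, a_c`,
setting `N := Σ d_i·a_i + (n+1-c)(d-c) - n` (so `N = d_1 + Σ_{i≥2} d_i·a_i + (n+1-c)(d-c) - n`),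
one has `m^N ⊆ J + (f_1, f_2^{a_2}, …, f_c^{a_c})`. -/
theorem stmt_9 {F : Type*} [Field F]
    (n c : ℕ) (hc : 0 < c) (f : Fin c → MvPolynomial (Fin (n + 1)) F) (D : Fin c → ℕ) (d : ℕ)
    (hfhom : ∀ i, (f i).IsHomogeneous (D i))
    (hreg : RingTheory.Sequence.IsRegular (MvPolynomial (Fin (n + 1)) F) (List.ofFn f))
    (hd : d = ∑ i, D i)
    (m J : Ideal (MvPolynomial (Fin (n + 1)) F))
    (hm : m = Ideal.span (Set.range X))
    (hJ : J = Ideal.span {g | ∃ r : Fin c → Fin (n + 1), Function.Injective r ∧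
      g = Matrix.det (Matrix.of fun i j : Fin c => pderiv (r i) (f j))})
    (hprimary : (J + Ideal.span (Set.range f)).radical = m)
    (a : Fin c → ℕ) (ha : ∀ i, 1 ≤ a i) (ha0 : a ⟨0, hc⟩ = 1) :
    m ^ (((∑ i, (D i : ℤ) * a i) + ((n : ℤ) + 1 - c) * ((d : ℤ) - c) - n).toNat) ≤
      J + Ideal.span (Set.range fun i => f i ^ a i) := by
  rw [Submodule.add_eq_sup] at hprimary ⊢
  have hfm : ∀ i, f i ∈ idealOfVars (Fin (n + 1)) F := fun i => by
    rw [idealOfVars, ← hm, ← hprimary]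
    exact Ideal.le_radical (Ideal.mem_sup_right (Ideal.subset_span ⟨i, rfl⟩))
  have hcn : c ≤ n + 1 := by simpa using card_le_of_isRegular hfm hreg
  have hD : ∀ i, 1 ≤ D i := by
    intro i
    by_contra! h
    have h0 := hfhom i
    rw [Nat.lt_one_iff.mp h, ← totalDegree_zero_iff_isHomogeneous, totalDegree_eq_zero_iff_eq_C]
      at h0
    have h1 := hfm i
    rw [mem_idealOfVars_iff, constantCoeff_eq] at h1
    rw [h1, C_0] at h0
    exact ne_zero_of_isRegular hreg i h0
  have hq : ((∑ i, (D i - 1) : ℕ) : ℤ) = d - c := by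
    rw [hd]
    push_cast [Nat.cast_sub (hD _)]
    simp
  have hN : ∀ N : ℕ,
      ((∑ i, (D i : ℤ) * a i) + ((n : ℤ) + 1 - c) * ((d : ℤ) - c) - n).toNat = N →
      ∑ i, D i * a i + (n + 1 - c) * ∑ i, (D i - 1) < N + (n + 1) := by
    intro N h
    have h1 := Int.self_le_toNat
      ((∑ i, (D i : ℤ) * a i) + ((n : ℤ) + 1 - c) * ((d : ℤ) - c) - n)
    rw [h, ← hq] at h1
    zify [hcn]
    push_cast at h1 ⊢
    linarith
  generalize ((∑ i, (D i : ℤ) * a i) + ((n : ℤ) + 1 - c) * ((d : ℤ) - c) - n).toNat = N at hN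
  rw [hm, ← idealOfVars, pow_idealOfVars_eq_span, Ideal.span_le]
  rintro _ ⟨x, hx, rfl⟩
  subst hJ
  refine mem_span_sup_span_range_pow_of_field hfhom hreg ?_ (hprimary.trans hm) ha
    (isHomogeneous_monomial 1 hx) (by simpa using hN N rfl)
  rintro _ ⟨r, -, rfl⟩
  exact isHomogeneous_det_pderiv hfhom r
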